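/- arXiv:cs/0403037 — 4 statements merged into one kernel-verified Lean document; each statement's English description precedes it below -/
import Mathlib

section
/- Let (D, ⊑) be a finite partial order with a least element ⊥, and let F be a finite set of functions from D to D, each of which is inflationary and monotonic. Then F has a least common fixpoint: there exists d ∈ D such that f(d) = d for every f ∈ F, and d ⊑ e for every e ∈ D satisfying f(e) = e for every f ∈ F. -/
/-- A finite partial order with least element ⊥, and a finite set
of inflationary and monotonic functions, has a least common fixpoint. -/
theorem least_common_fixpoint_exists
    {D : Type*} [PartialOrder D] [OrderBot D] [Fintype D]
    (F : Finset (D → D))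
    (hinf : ∀ f ∈ F, ∀ x : D, x ≤ f x)
    (hmono : ∀ f ∈ F, ∀ x y : D, x ≤ y → f x ≤ f y) :
    ∃ d : D, (∀ f ∈ F, f d = d) ∧ ∀ e : D, (∀ f ∈ F, f e = e) → d ≤ e := by
  obtain ⟨d, hd⟩ := (Set.toFinite (lowerBounds {e : D | ∀ f ∈ F, f e = e})).exists_maximal
    ⟨⊥, fun _ _ => bot_le⟩
  refine ⟨d, fun f hf => ?_, fun e he => hd.prop he⟩
  have hfd : f d ∈ lowerBounds {e : D | ∀ f ∈ F, f e = e} := fun e he =>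
    (hmono f hf d e (hd.prop he)).trans_eq (he f hf)
  exact (hd.eq_of_le hfd (hinf f hf d)).symm
end

section
/- Let (D, ⊑) be a finite partial order and let F be a finite set of functions from D to D, each of which is inflationary and monotonic. Then for every a ∈ D there exists a least common fixpoint of F above a: an element d with a ⊑ d, f(d) = d for every f ∈ F, and d ⊑ e for every e ∈ D satisfying a ⊑ e and f(e) = e for every f ∈ F. -/
/-- In a finite partial order, a finite set of inflationary and
monotonic functions has, above every element `a`, a least common fixpoint. -/
theorem least_common_fixpoint_above_exists
    {D : Type*} [PartialOrder D] [Fintype D]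
    (F : Finset (D → D))
    (hinf : ∀ f ∈ F, ∀ x : D, x ≤ f x)
    (hmono : ∀ f ∈ F, ∀ x y : D, x ≤ y → f x ≤ f y)
    (a : D) :
    ∃ d : D, a ≤ d ∧ (∀ f ∈ F, f d = d) ∧
      ∀ e : D, a ≤ e → (∀ f ∈ F, f e = e) → d ≤ e := by
  let S : Set D := {x | a ≤ x ∧ ∀ e : D, a ≤ e → (∀ f ∈ F, f e = e) → x ≤ e}
  have hS : S.Nonempty := ⟨a, le_rfl, fun _ hae _ => hae⟩
  obtain ⟨d, ⟨had, hde⟩, hmax⟩ := S.toFinite.exists_maximal hS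
  refine ⟨d, had, fun f hf => ?_, hde⟩
  have hfd : f d ∈ S := ⟨had.trans (hinf f hf d), fun e hae he =>
    (hmono f hf d e (hde e hae he)).trans_eq (he f hf)⟩
  exact (hmax hfd (hinf f hf d)).antisymm (hinf f hf d)
end

section
/- Let (D, ⊑) be a partial order and F a set of functions from D to D. Let b : D → Prop be a condition with witness w (so b(w) holds and w ⊑ d for every d with b(d)), and let g : D → D be stable. Suppose e ∈ D is a least common fixpoint of F above w, i.e., w ⊑ e, e is a common fixpoint of F, and e ⊑ d for every common fixpoint d of F with w ⊑ d. If g(e) = e, then every common fixpoint d of F is a fixpoint of the rule b → g, i.e., (b → g)(d) = d; hence the rule b → g is redundant with respect to F. -/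
open Classical in
/-- Application of a rule `b → g`: apply the body `g` if the condition `b` holds. -/
noncomputable def ruleApply {D : Type*} (b : D → Prop) (g : D → D) (d : D) : D :=
  if b d then g d else d

/-- Redundancy test for prop rules: if `w` is the witness of `b`,
`g` is stable, `e` is the least common fixpoint of `F` above `w`, and
`g e = e`, then every common fixpoint of `F` is a fixpoint of the rule
`b → g`; hence `b → g` is redundant with respect to `F`. -/
theorem rule_redundancy_test
    {D : Type*} [PartialOrder D]
    (F : Set (D → D)) (b : D → Prop) (g : D → D) (w : D)
    (hwitness : b w ∧ ∀ d : D, b d → w ≤ d)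
    (hstable : ∀ d e : D, g d ≤ e → g e = e)
    (e : D)
    (hwe : w ≤ e)
    (hefix : ∀ f ∈ F, f e = e)
    (heleast : ∀ d : D, w ≤ d → (∀ f ∈ F, f d = d) → e ≤ d)
    (hge : g e = e) :
    (∀ d : D, (∀ f ∈ F, f d = d) → ruleApply b g d = d) ∧
    ({d : D | ∀ f ∈ F ∪ {ruleApply b g}, f d = d} = {d : D | ∀ f ∈ F, f d = d}) := by
  have hfix : ∀ d : D, (∀ f ∈ F, f d = d) → ruleApply b g d = d := by
    intro d hd
    unfold ruleApply
    split_ifs with hb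
    · exact hstable e d (hge.le.trans (heleast d (hwitness.2 d hb) hd))
    · rfl
  refine ⟨hfix, Set.ext fun d => ⟨fun h f hf => h f (Or.inl hf), ?_⟩⟩
  rintro h f (hf | rfl)
  · exact h f hf
  · exact hfix d h
end

section
/- Let (D, ⊑) be a partial order, b : D → Prop a condition, and g₁, …, g_n : D → D inflationary functions. Then for every d ∈ D, d is a fixpoint of the rule b → (g₁ ∘ g₂ ∘ ⋯ ∘ g_n) (with composite body applying g_n first) if and only if d is a fixpoint of the rule b → g_i for every i ∈ {1, …, n}. -/
theorem le_foldr_comp_of_inflationary {D : Type*} [Preorder D] (l : List (D → D))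
    (hl : ∀ f ∈ l, ∀ x, x ≤ f x) (d : D) : d ≤ l.foldr (· ∘ ·) id d := by
  induction l with
  | nil => exact le_rfl
  | cons f l ih =>
    rw [List.forall_mem_cons] at hl
    exact (ih hl.2).trans (hl.1 _)

theorem foldr_comp_eq_self_iff {D : Type*} [PartialOrder D] (l : List (D → D))
    (hl : ∀ f ∈ l, ∀ x, x ≤ f x) (d : D) :
    l.foldr (· ∘ ·) id d = d ↔ ∀ f ∈ l, f d = d := by
  induction l with
  | nil => simp
  | cons f l ih =>
    rw [List.forall_mem_cons] at hl ⊢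
    rw [← ih hl.2, List.foldr_cons, Function.comp_apply]
    refine ⟨fun h => ?_, fun ⟨hf, hd⟩ => by rw [hd, hf]⟩
    have hd : l.foldr (· ∘ ·) id d = d :=
      le_antisymm ((hl.1 _).trans_eq h) (le_foldr_comp_of_inflationary l hl.2 d)
    exact ⟨by rwa [hd] at h, hd⟩

theorem ruleApply_eq_self_iff {D : Type*} (b : D → Prop) (g : D → D) (d : D) :
    ruleApply b g d = d ↔ (b d → g d = d) := by
  by_cases h : b d <;> simp [ruleApply, h]

/-- For inflationary bodies `g₁, …, gₙ`, an element `d` is a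
fixpoint of the rule `b → (g₁ ∘ ⋯ ∘ gₙ)` (applying `gₙ` first) iff it is a
fixpoint of every rule `b → gᵢ`. -/
theorem rule_composite_fixpoint_iff
    {D : Type*} [PartialOrder D]
    (b : D → Prop) (n : ℕ) (g : Fin n → D → D)
    (hinf : ∀ i : Fin n, ∀ x : D, x ≤ g i x) :
    ∀ d : D,
      ruleApply b ((List.ofFn g).foldr (· ∘ ·) id) d = d ↔
        ∀ i : Fin n, ruleApply b (g i) d = d := by
  intro d
  have hl : ∀ f ∈ List.ofFn g, ∀ x, x ≤ f x := by
    simpa only [List.forall_mem_ofFn_iff] using hinf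
  simp only [ruleApply_eq_self_iff, foldr_comp_eq_self_iff _ hl, List.forall_mem_ofFn_iff]
  exact forall_comm
end
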